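/- arXiv:2307.13183 — 2 statements merged into one kernel-verified Lean document; each statement's English description precedes it below -/
import Mathlib

section
/- Let r ≥ 2, α ∈ F_{q^r}^× and β ∈ F_{q^r} with Tr(β) = 0. Then the number of affine F_{q^r}-points of X_{q,r} on the line y = αx + β satisfies n_{q,r}(α,β) ≥ q^{r−1} − (r−1)(q−1)q^{(r−2)/2}. -/
namespace NTaux

open Finset

section core

variable {K F : Type*} [Field K] [Fintype K] [Field F] [Fintype F] [Algebra K F]

open Classical in
lemma count_ker (W : Submodule K F) (L : F →ₗ[K] K) (w : F) (hw : w ∈ W) (hL : L w ≠ 0) :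
    (univ.filter (fun v : F => v ∈ W ∧ L v = 0)).card * Fintype.card K
      = (univ.filter (fun v : F => v ∈ W)).card := by
  have hu : L ((L w)⁻¹ • w) = 1 := by simp [hL]
  have huW : (L w)⁻¹ • w ∈ W := W.smul_mem _ hw
  generalize (L w)⁻¹ • w = u at hu huW
  rw [← Finset.card_univ (α := K), ← Finset.card_product]
  refine Finset.card_bij' (fun x _ => x.1 + x.2 • u) (fun v _ => (v - L v • u, L v)) ?_ ?_ ?_ ?_
  · rintro ⟨v, c⟩ h
    simp only [mem_product, mem_filter, mem_univ, true_and, and_true] at h ⊢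
    exact W.add_mem h.1 (W.smul_mem _ huW)
  · intro v h
    simp only [mem_product, mem_filter, mem_univ, true_and, and_true] at h ⊢
    exact ⟨W.sub_mem h (W.smul_mem _ huW), by simp [hu]⟩
  · rintro ⟨v, c⟩ h
    simp only [mem_product, mem_filter, mem_univ, true_and, and_true] at h
    simp [h.2, hu]
  · intro v h
    simp

/-- the functional `v ↦ Tr (η v)` -/
noncomputable def TT (K : Type*) {F : Type*} [Field K] [Field F] [Algebra K F] (η : F) :
    F →ₗ[K] K := (Algebra.trace K F) ∘ₗ (LinearMap.mulLeft K η)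

lemma TT_apply (η v : F) : TT K η v = Algebra.trace K F (η * v) := rfl

lemma norm_div' (x y : F) (hy : y ≠ 0) :
    Algebra.norm K (x / y) = Algebra.norm K x / Algebra.norm K y := by
  have hn : Algebra.norm K y ≠ 0 := by rwa [Algebra.norm_ne_zero_iff]
  rw [eq_div_iff hn, ← map_mul, div_mul_cancel₀ _ hy]

lemma TT_ne (η : F) (h : η ≠ 0) : ∃ v, TT K η v = 1 := by
  obtain ⟨u, hu⟩ := Algebra.trace_surjective K F 1
  refine ⟨η⁻¹ * u, ?_⟩
  rw [TT_apply, mul_inv_cancel_left₀ h, hu]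

lemma exists_sep (η : F) (h : ∀ c : K, algebraMap K F c ≠ η) :
    ∃ w, TT K η w = 0 ∧ Algebra.trace K F w ≠ 0 := by
  by_contra! hc
  have h0 : η ≠ 0 := fun h' => h 0 (by simp [h'])
  obtain ⟨u, hu⟩ := TT_ne (K := K) η h0
  set c := Algebra.trace K F u
  have key : ∀ w, Algebra.trace K F w = c * TT K η w := by
    intro w
    have := hc (w - TT K η w • u) (by simp [hu])
    rw [map_sub, map_smul, sub_eq_zero] at this
    rw [this, smul_eq_mul, mul_comm]
  have h1 : 1 - algebraMap K F c * η = 0 := by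
    by_contra hne
    obtain ⟨v, hv⟩ := TT_ne (K := K) _ hne
    rw [TT_apply, sub_mul, one_mul, map_sub, key v, mul_assoc, ← Algebra.smul_def, map_smul,
      TT_apply, smul_eq_mul, sub_self] at hv
    exact zero_ne_one hv
  have hc0 : c ≠ 0 := by
    intro h'
    simp [h'] at h1
  apply h c⁻¹
  rw [map_inv₀]
  have : algebraMap K F c ≠ 0 := by simpa using hc0
  field_simp
  linear_combination h1

open Classical in
lemma card_trace_ne (s : ℕ) (hF : Fintype.card F = Fintype.card K ^ (s + 1)) :
    ((univ.filter (fun v : F => Algebra.trace K F v ≠ 0)).card : ℝ)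
      = (Fintype.card K : ℝ) ^ s * (Fintype.card K - 1) := by
  obtain ⟨u, hu⟩ := Algebra.trace_surjective K F 1
  have h := count_ker (K := K) (F := F) ⊤ (Algebra.trace K F) u trivial (by simp [hu])
  simp only [Submodule.mem_top, true_and, filter_true, card_univ, hF, pow_succ] at h
  have hq : 0 < Fintype.card K := Fintype.card_pos
  have h := Nat.eq_of_mul_eq_mul_right hq h
  have h2 := card_filter_add_card_filter_not (s := (univ : Finset F))
    (fun v : F => Algebra.trace K F v = 0)
  rw [h, card_univ, hF] at h2
  have h3 : ((Fintype.card K : ℝ)) ^ s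
      + ((univ.filter (fun v : F => ¬ Algebra.trace K F v = 0)).card : ℝ)
      = (Fintype.card K : ℝ) ^ (s + 1) := by exact_mod_cast h2
  rw [pow_succ] at h3
  simp only [ne_eq]
  linarith

open Classical in
lemma card_trace_ne' (s : ℕ) (hF : Fintype.card F = Fintype.card K ^ (s + 2))
    (η : F) (hη : ∀ c : K, algebraMap K F c ≠ η) :
    ((univ.filter (fun v : F => TT K η v = 0 ∧ Algebra.trace K F v ≠ 0)).card : ℝ)
      = (Fintype.card K : ℝ) ^ s * (Fintype.card K - 1) := by
  have hq : 0 < Fintype.card K := Fintype.card_pos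
  have h0 : η ≠ 0 := fun h' => hη 0 (by simp [h'])
  obtain ⟨u, hu⟩ := TT_ne (K := K) η h0
  have h := count_ker (K := K) (F := F) ⊤ (TT K η) u trivial (by simp [hu])
  simp only [Submodule.mem_top, true_and, filter_true, card_univ, hF] at h
  rw [pow_succ] at h
  have h := Nat.eq_of_mul_eq_mul_right hq h
  obtain ⟨w, hw, hw'⟩ := exists_sep η hη
  have g := count_ker (K := K) (F := F) (LinearMap.ker (TT K η)) (Algebra.trace K F) w
    (by simpa using hw) hw'
  simp only [LinearMap.mem_ker] at g
  rw [h, pow_succ] at g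
  have g := Nat.eq_of_mul_eq_mul_right hq g
  have h2 := card_filter_add_card_filter_not (s := (univ.filter (fun v : F => TT K η v = 0)))
    (fun v : F => Algebra.trace K F v = 0)
  rw [filter_filter, filter_filter, h, g] at h2
  have h3 : ((Fintype.card K : ℝ)) ^ s
      + ((univ.filter (fun v : F => TT K η v = 0 ∧ ¬ Algebra.trace K F v = 0)).card : ℝ)
      = (Fintype.card K : ℝ) ^ (s + 1) := by exact_mod_cast h2
  rw [pow_succ] at h3
  simp only [ne_eq]
  linarith

open Classical in
lemma card_alg : ((univ.filter (fun e : F => ∀ c : K, algebraMap K F c ≠ e)).card : ℝ)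
    = Fintype.card F - Fintype.card K := by
  have h2 := card_filter_add_card_filter_not (s := (univ : Finset F))
    (fun e : F => ∃ c : K, algebraMap K F c = e)
  have h3 : (univ.filter (fun e : F => ∃ c : K, algebraMap K F c = e)).card = Fintype.card K := by
    rw [← card_univ, ← card_image_of_injective univ (algebraMap K F).injective]
    congr 1
    ext e; simp
  rw [h3, card_univ] at h2
  simp only [not_exists] at h2
  rw [← h2]
  push_cast
  simp

open Classical in
lemma card_roots (s : ℕ) :
    (univ.filter (fun e : F => ∃ c : K, c ^ (s + 1) = 1 ∧ algebraMap K F c = e)).card ≤ s + 1 := by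
  have : (univ.filter (fun e : F => ∃ c : K, c ^ (s + 1) = 1 ∧ algebraMap K F c = e))
      ⊆ (Polynomial.nthRootsFinset (s + 1) (1 : K)).image (algebraMap K F) := by
    intro e he
    simp only [mem_filter, mem_univ, true_and] at he
    obtain ⟨c, hc, rfl⟩ := he
    refine mem_image_of_mem _ ?_
    rw [Polynomial.mem_nthRootsFinset (by omega)]
    exact hc
  refine (card_le_card this).trans (card_image_le.trans ?_)
  unfold Polynomial.nthRootsFinset
  exact (Multiset.toFinset_card_le _).trans (Polynomial.card_nthRoots _ _)

open Classical in
/-- the pair count for a fixed ratio -/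
lemma ratio_bound (s : ℕ) (hF : Fintype.card F = Fintype.card K ^ (s + 2)) (e : F) (he : e ≠ 0) :
    ((univ.filter (fun v : F => Algebra.trace K F v ≠ 0 ∧
      Algebra.trace K F (e * v) = Algebra.norm K e * Algebra.trace K F v)).card : ℝ)
    ≤ (if ∃ c : K, c ^ (s + 1) = 1 ∧ algebraMap K F c = e then
        (Fintype.card K : ℝ) ^ (s + 1) * (Fintype.card K - 1) else 0)
      + (if ∀ c : K, algebraMap K F c ≠ e then
        (Fintype.card K : ℝ) ^ s * (Fintype.card K - 1) else 0) := by
  have hq : (1 : ℝ) ≤ Fintype.card K := by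
    exact_mod_cast (Fintype.card_pos : 0 < Fintype.card K)
  have hn1 : 0 ≤ (Fintype.card K : ℝ) ^ (s + 1) * (Fintype.card K - 1) :=
    mul_nonneg (by positivity) (by linarith)
  have hn2 : 0 ≤ (Fintype.card K : ℝ) ^ s * (Fintype.card K - 1) :=
    mul_nonneg (by positivity) (by linarith)
  by_cases h : ∀ c : K, algebraMap K F c ≠ e
  · rw [if_pos h]
    have hη : ∀ c : K, algebraMap K F c ≠ e - algebraMap K F (Algebra.norm K e) := by
      intro c hc
      apply h (c + Algebra.norm K e)
      rw [map_add, hc]; ring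
    rw [← card_trace_ne' s hF _ hη]
    have : (univ.filter (fun v : F => Algebra.trace K F v ≠ 0 ∧
      Algebra.trace K F (e * v) = Algebra.norm K e * Algebra.trace K F v)).card ≤
      (univ.filter (fun v : F => TT K (e - algebraMap K F (Algebra.norm K e)) v = 0
        ∧ Algebra.trace K F v ≠ 0)).card := by
      apply card_le_card
      intro v hv
      simp only [mem_filter, mem_univ, true_and] at hv ⊢
      refine ⟨?_, hv.1⟩
      rw [TT_apply, sub_mul, map_sub, hv.2, ← Algebra.smul_def, map_smul, smul_eq_mul, sub_self]
    have : ((univ.filter (fun v : F => Algebra.trace K F v ≠ 0 ∧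
      Algebra.trace K F (e * v) = Algebra.norm K e * Algebra.trace K F v)).card : ℝ) ≤
      (univ.filter (fun v : F => TT K (e - algebraMap K F (Algebra.norm K e)) v = 0
        ∧ Algebra.trace K F v ≠ 0)).card := by exact_mod_cast this
    split_ifs <;> linarith
  · rw [if_neg h, add_zero]
    push Not at h
    obtain ⟨c, rfl⟩ := h
    have hr : Module.finrank K F = s + 2 := by
      have := Module.card_eq_pow_finrank (K := K) (V := F)
      rw [hF] at this
      exact (Nat.pow_right_injective (Fintype.one_lt_card (α := K)) this).symm
    have hc0 : c ≠ 0 := by rintro rfl; simp at he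
    by_cases h1 : c ^ (s + 1) = 1
    · rw [if_pos ⟨c, h1, rfl⟩, ← card_trace_ne (s + 1) hF]
      have : (univ.filter (fun v : F => Algebra.trace K F v ≠ 0 ∧
        Algebra.trace K F (algebraMap K F c * v) = Algebra.norm K (algebraMap K F c) *
          Algebra.trace K F v)).card ≤
        (univ.filter (fun v : F => Algebra.trace K F v ≠ 0)).card := by
        apply card_le_card
        intro v hv
        simp only [mem_filter, mem_univ, true_and] at hv ⊢
        exact hv.1
      exact_mod_cast this
    · have : (univ.filter (fun v : F => Algebra.trace K F v ≠ 0 ∧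
        Algebra.trace K F (algebraMap K F c * v) = Algebra.norm K (algebraMap K F c) *
          Algebra.trace K F v)) = ∅ := by
        apply filter_eq_empty_iff.2
        rintro v - ⟨hv, hv'⟩
        rw [Algebra.norm_algebraMap, hr, ← Algebra.smul_def, map_smul, smul_eq_mul] at hv'
        have := mul_right_cancel₀ hv hv'
        apply h1
        rw [pow_succ] at this
        exact (mul_right_cancel₀ hc0 (by rw [one_mul]; exact this)).symm
      rw [this]
      split_ifs <;> simp
      exact hn1

/-- ratio -/
noncomputable def phi (K : Type*) {F : Type*} [Field K] [Field F] [Algebra K F] (v : F) : K :=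
  Algebra.norm K v / Algebra.trace K F v

open Classical in
lemma pair_bound (s : ℕ) (hF : Fintype.card F = Fintype.card K ^ (s + 2)) :
    ∑ a ∈ univ.filter (fun a : K => a ≠ 0),
      ((univ.filter (fun v : F => Algebra.trace K F v ≠ 0 ∧ phi K v = a)).card : ℝ) ^ 2
    ≤ (s + 1) * ((Fintype.card K : ℝ) ^ (s + 1) * (Fintype.card K - 1))
      + ((Fintype.card K : ℝ) ^ (s + 2) - Fintype.card K) *
        ((Fintype.card K : ℝ) ^ s * (Fintype.card K - 1)) := by
  have hq : (1 : ℝ) ≤ Fintype.card K := by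
    exact_mod_cast (Fintype.card_pos : 0 < Fintype.card K)
  have hn1 : 0 ≤ (Fintype.card K : ℝ) ^ (s + 1) * (Fintype.card K - 1) :=
    mul_nonneg (by positivity) (by linarith)
  have hne : ∀ v : F, Algebra.trace K F v ≠ 0 → v ≠ 0 := by
    rintro v hv rfl
    simp at hv
  set P : Finset (F × F) := univ.filter (fun x => Algebra.trace K F x.1 ≠ 0 ∧
    Algebra.trace K F x.2 ≠ 0 ∧ phi K x.1 = phi K x.2) with hP
  set Q : Finset (F × F) := univ.filter (fun x => x.2 ≠ 0 ∧ Algebra.trace K F x.1 ≠ 0 ∧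
      Algebra.trace K F (x.2 * x.1) = Algebra.norm K x.2 * Algebra.trace K F x.1) with hQ
  have h1 : ∑ a ∈ univ.filter (fun a : K => a ≠ 0),
      (univ.filter (fun v : F => Algebra.trace K F v ≠ 0 ∧ phi K v = a)).card ^ 2 = P.card := by
    rw [card_eq_sum_card_fiberwise (f := fun x : F × F => phi K x.1) (s := P)
      (t := univ.filter (fun a : K => a ≠ 0))]
    · refine sum_congr rfl fun a _ => ?_
      rw [sq, ← card_product]
      congr 1
      ext ⟨x, y⟩
      simp only [hP, mem_product, mem_filter, mem_univ, true_and]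
      constructor
      · rintro ⟨⟨a1, a2⟩, a3, a4⟩
        exact ⟨⟨a1, a3, a2.trans a4.symm⟩, a2⟩
      · rintro ⟨⟨a1, a2, a3⟩, a4⟩
        exact ⟨⟨a1, a4⟩, a2, a3.symm.trans a4⟩
    · rintro ⟨x, y⟩ h
      simp only [hP, coe_filter, Set.mem_ofPred_eq, mem_univ, true_and] at h ⊢
      exact div_ne_zero (by rw [Algebra.norm_ne_zero_iff]; exact hne x h.1) h.1
  have h2 : P.card ≤ Q.card := by
    apply card_le_card_of_injOn (fun x => (x.1, x.2 / x.1))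
    · rintro ⟨x, y⟩ h
      simp only [hP, hQ, coe_filter, Set.mem_ofPred_eq, mem_univ, true_and] at h ⊢
      obtain ⟨a1, a2, a3⟩ := h
      have hx := hne x a1
      have hy := hne y a2
      refine ⟨div_ne_zero hy hx, a1, ?_⟩
      rw [div_mul_cancel₀ _ hx, norm_div' y x hx]
      have hnx : Algebra.norm K x ≠ 0 := by rw [Algebra.norm_ne_zero_iff]; exact hx
      unfold phi at a3
      field_simp at a3 ⊢
      linear_combination a3
    · rintro ⟨x, y⟩ h ⟨x', y'⟩ h' heq
      simp only [hP, coe_filter, Set.mem_ofPred_eq, mem_univ, true_and] at h h'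
      simp only [Prod.mk.injEq] at heq ⊢
      obtain ⟨rfl, h3⟩ := heq
      have hx := hne x h.1
      exact ⟨rfl, (div_left_inj' hx).1 h3⟩
  have h3 : Q.card = ∑ e : F, (Q.filter (fun x => x.2 = e)).card :=
    card_eq_sum_card_fiberwise (fun x _ => by simp)
  have h4 : (Q.card : ℝ) ≤ ∑ e : F,
      ((if ∃ c : K, c ^ (s + 1) = 1 ∧ algebraMap K F c = e then
        (Fintype.card K : ℝ) ^ (s + 1) * (Fintype.card K - 1) else 0)
      + (if ∀ c : K, algebraMap K F c ≠ e then
        (Fintype.card K : ℝ) ^ s * (Fintype.card K - 1) else 0)) := by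
    rw [h3, Nat.cast_sum]
    refine sum_le_sum fun e _ => ?_
    by_cases he : e = 0
    · have : Q.filter (fun x => x.2 = e) = ∅ := by
        apply filter_eq_empty_iff.2
        rintro ⟨x, y⟩ h
        simp only [hQ, mem_filter, mem_univ, true_and] at h
        rw [he]
        exact h.1
      rw [this, card_empty, Nat.cast_zero]
      refine add_nonneg ?_ ?_ <;> split_ifs <;>
        first | exact le_rfl | exact mul_nonneg (by positivity) (by linarith)
    · refine le_trans ?_ (ratio_bound s hF e he)
      norm_cast
      apply card_le_card_of_injOn (fun x => x.1)
      · rintro ⟨x, y⟩ h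
        simp only [hQ, coe_filter, Set.mem_ofPred_eq, mem_filter, mem_univ, true_and] at h ⊢
        obtain ⟨h, rfl⟩ := h
        exact h.2
      · rintro ⟨x, y⟩ h ⟨x', y'⟩ h' heq
        simp only [coe_filter, Set.mem_ofPred_eq] at h h' heq
        rw [heq, h.2, h'.2]
  rw [sum_add_distrib, ← sum_filter, ← sum_filter, sum_const, sum_const, nsmul_eq_mul,
    nsmul_eq_mul, card_alg, hF] at h4
  have h5 : ((univ.filter (fun e : F => ∃ c : K, c ^ (s + 1) = 1 ∧ algebraMap K F c = e)).card : ℝ)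
      ≤ s + 1 := by exact_mod_cast card_roots (K := K) (F := F) s
  have h6 := mul_le_mul_of_nonneg_right h5 hn1
  have h7 : (P.card : ℝ) ≤ Q.card := by exact_mod_cast h2
  have h8 := congrArg (Nat.cast : ℕ → ℝ) h1
  push_cast at h8 h4
  linarith

open Classical in
lemma core_bound (s : ℕ) (hF : Fintype.card F = Fintype.card K ^ (s + 2)) (a : K) (ha : a ≠ 0) :
    (((univ.filter (fun v : F => Algebra.trace K F v ≠ 0 ∧ phi K v = a)).card : ℝ)
      - (Fintype.card K : ℝ) ^ (s + 1)) ^ 2 ≤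
    s * (Fintype.card K : ℝ) ^ (s + 1) * (Fintype.card K - 1) := by
  have hb := pair_bound (K := K) (F := F) s hF
  have h1 : (univ.filter (fun v : F => Algebra.trace K F v ≠ 0)).card =
      ∑ a ∈ univ.filter (fun a : K => a ≠ 0),
      (univ.filter (fun v : F => Algebra.trace K F v ≠ 0 ∧ phi K v = a)).card := by
    rw [card_eq_sum_card_fiberwise (f := phi K) (t := univ.filter (fun a : K => a ≠ 0))]
    · simp only [filter_filter]
    · intro x h
      simp only [coe_filter, Set.mem_ofPred_eq, mem_univ, true_and] at h ⊢
      refine div_ne_zero ?_ h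
      rw [Algebra.norm_ne_zero_iff]
      rintro rfl
      simp at h
  have h1 := congrArg (Nat.cast : ℕ → ℝ) h1
  rw [card_trace_ne (s + 1) hF] at h1
  push_cast at h1
  have hc : ((univ.filter (fun a : K => a ≠ 0)).card : ℝ) = Fintype.card K - 1 := by
    rw [filter_ne', card_erase_of_mem (mem_univ _), card_univ,
      Nat.cast_sub Fintype.card_pos, Nat.cast_one]
  refine (single_le_sum (f := fun a : K =>
    (((univ.filter (fun v : F => Algebra.trace K F v ≠ 0 ∧ phi K v = a)).card : ℝ)
      - (Fintype.card K : ℝ) ^ (s + 1)) ^ 2) (fun i _ => sq_nonneg _)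
      (show a ∈ univ.filter (fun a : K => a ≠ 0) by simpa using ha)).trans ?_
  simp only [sub_sq, sum_add_distrib, sum_sub_distrib, sum_const, nsmul_eq_mul, ← sum_mul,
    ← mul_sum, hc]
  rw [← h1]
  refine (add_le_add_left (sub_le_sub_right hb _) _).trans (le_of_eq ?_)
  ring

end core

lemma real_bound (s q : ℕ) (hq : 2 ≤ q) (M : ℝ)
    (h : (M - (q : ℝ) ^ (s + 1)) ^ 2 ≤ s * (q : ℝ) ^ (s + 1) * (q - 1)) :
    M ≥ (q : ℝ) ^ (s + 1) - ((s : ℝ) + 1) * ((q : ℝ) - 1) * (q : ℝ) ^ ((s : ℝ) / 2) := by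
  have hq' : (2 : ℝ) ≤ q := by exact_mod_cast hq
  have hR : ((q : ℝ) ^ ((s : ℝ) / 2)) ^ 2 = (q : ℝ) ^ s := by
    rw [← Real.rpow_natCast, ← Real.rpow_mul (by positivity)]
    norm_num
  have hs : (0 : ℝ) ≤ s := by positivity
  have hB : 0 ≤ ((s : ℝ) + 1) * ((q : ℝ) - 1) * (q : ℝ) ^ ((s : ℝ) / 2) :=
    mul_nonneg (mul_nonneg (by positivity) (by linarith)) (by positivity)
  have h2 : (M - (q : ℝ) ^ (s + 1)) ^ 2
      ≤ (((s : ℝ) + 1) * ((q : ℝ) - 1) * (q : ℝ) ^ ((s : ℝ) / 2)) ^ 2 := by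
    refine h.trans ?_
    rw [mul_pow, hR, mul_pow, pow_succ]
    have hp : (0 : ℝ) ≤ (q : ℝ) ^ s * (q - 1) := mul_nonneg (by positivity) (by linarith)
    have : (s : ℝ) * q ≤ (s + 1) ^ 2 * (q - 1) := by nlinarith [sq_nonneg (s : ℝ)]
    have := mul_le_mul_of_nonneg_left this hp
    linarith
  have := abs_le_of_sq_le_sq' h2 hB
  linarith [this.1]

lemma exists_subfield {F : Type*} [Field F] [Fintype F] (q r : ℕ)
    (hq : ∃ p k : ℕ, p.Prime ∧ 0 < k ∧ q = p ^ k) (hr : 2 ≤ r)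
    (hcard : Fintype.card F = q ^ r) :
    ∃ (K : Type) (_ : Field K) (_ : Fintype K) (_ : Algebra K F), Fintype.card K = q := by
  obtain ⟨p, k, hp, hk, rfl⟩ := hq
  haveI : Fact p.Prime := ⟨hp⟩
  haveI : CharP F p := by
    have hc : (p : F) = 0 := by
      have : ((Fintype.card F : ℕ) : F) = 0 := Nat.cast_card_eq_zero F
      rw [hcard] at this
      push_cast at this
      exact pow_eq_zero_iff (by omega : k ≠ 0) |>.1 (pow_eq_zero_iff (by omega : r ≠ 0) |>.1 this)
    exact (CharP.charP_iff_prime_eq_zero hp).2 hc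
  letI : Algebra (ZMod p) F := ZMod.algebra F p
  have h1 : Module.finrank (ZMod p) F = k * r := by
    have := Module.card_eq_pow_finrank (K := ZMod p) (V := F)
    rw [hcard, ZMod.card, ← pow_mul] at this
    exact (Nat.pow_right_injective hp.two_le this).symm
  haveI : Fintype (GaloisField p k) := Fintype.ofFinite _
  obtain ⟨f⟩ := FiniteField.nonempty_algHom_of_finrank_dvd (F := ZMod p) (K := GaloisField p k)
    (L := F) (by rw [h1, GaloisField.finrank p hk.ne']; exact dvd_mul_right _ _)
  refine ⟨GaloisField p k, inferInstance, inferInstance, f.toRingHom.toAlgebra, ?_⟩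
  rw [← Nat.card_eq_fintype_card, GaloisField.card p k hk.ne']

end NTaux

/-- For `r ≥ 2`, `α ≠ 0` and `Tr(β) = 0`, the number of affine
`F_{q^r}`-points of the norm-trace curve on the line `y = αx + β` satisfies
`n_{q,r}(α,β) ≥ q^(r-1) - (r-1)(q-1)q^((r-2)/2)`. -/
theorem norm_trace_intersection_lower_bound_trace_zero {F : Type*} [Field F] [Fintype F]
    [DecidableEq F] (q r : ℕ) (hq : ∃ p k : ℕ, p.Prime ∧ 0 < k ∧ q = p ^ k) (hr : 2 ≤ r)
    (hcard : Fintype.card F = q ^ r) (α β : F) (hα : α ≠ 0)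
    (htr : (∑ i ∈ Finset.range r, β ^ q ^ i) = 0) :
    ((Finset.univ.filter
        (fun p : F × F => p.2 = α * p.1 + β ∧
          ∑ i ∈ Finset.range r, p.2 ^ q ^ i = p.1 ^ ((q ^ r - 1) / (q - 1)))).card : ℝ)
      ≥ (q : ℝ) ^ (r - 1)
        - ((r : ℝ) - 1) * ((q : ℝ) - 1) * (q : ℝ) ^ (((r : ℝ) - 2) / 2) := by
  classical
  obtain ⟨K, _, _, _, hK⟩ := NTaux.exists_subfield (F := F) q r hq hr hcard
  obtain ⟨s, rfl⟩ : ∃ s, r = s + 2 := ⟨r - 2, by omega⟩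
  have hF : Fintype.card F = Fintype.card K ^ (s + 2) := by rw [hcard, hK]
  have hrk : Module.finrank K F = s + 2 := by
    have := Module.card_eq_pow_finrank (K := K) (V := F)
    rw [hF] at this
    exact (Nat.pow_right_injective (Fintype.one_lt_card (α := K)) this).symm
  have hT : ∀ x : F, ∑ i ∈ Finset.range (s + 2), x ^ q ^ i
      = algebraMap K F (Algebra.trace K F x) := by
    intro x
    rw [FiniteField.algebraMap_trace_eq_sum_pow, hrk, Nat.card_eq_fintype_card, hK]
  have hN : ∀ x : F, x ^ ((q ^ (s + 2) - 1) / (q - 1)) = algebraMap K F (Algebra.norm K x) := by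
    intro x
    rw [FiniteField.algebraMap_norm_eq_pow, Nat.card_eq_fintype_card, Nat.card_eq_fintype_card,
      hK, hcard]
  have hq2 : 2 ≤ q := by rw [← hK]; exact Fintype.one_lt_card
  have hNα : Algebra.norm K α ≠ 0 := by rwa [Algebra.norm_ne_zero_iff]
  have hβ : Algebra.trace K F β = 0 := by
    rw [hT] at htr
    simpa using htr
  have hcore := NTaux.core_bound (K := K) (F := F) s hF (Algebra.norm K α) hNα
  rw [hK] at hcore
  have hfin := NTaux.real_bound s q hq2 _ hcore
  have hle : (Finset.univ.filter (fun v : F => Algebra.trace K F v ≠ 0 ∧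
      NTaux.phi K v = Algebra.norm K α)).card ≤ (Finset.univ.filter
        (fun p : F × F => p.2 = α * p.1 + β ∧ ∑ i ∈ Finset.range (s + 2), p.2 ^ q ^ i
          = p.1 ^ ((q ^ (s + 2) - 1) / (q - 1)))).card := by
    apply Finset.card_le_card_of_injOn (fun v => (v / α, v + β))
    · intro v h
      simp only [Finset.coe_filter, Set.mem_ofPred_eq, Finset.mem_univ, true_and] at h ⊢
      refine ⟨by field_simp, ?_⟩
      rw [hT, hN, map_add, hβ, add_zero, NTaux.norm_div' v α hα]
      congr 1
      have h1 := h.1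
      have h2 := h.2
      unfold NTaux.phi at h2
      field_simp at h2 ⊢
      linear_combination -h2
    · intro v _ w _ h
      simpa using congrArg Prod.snd h
  have hle' : ((Finset.univ.filter (fun v : F => Algebra.trace K F v ≠ 0 ∧
      NTaux.phi K v = Algebra.norm K α)).card : ℝ) ≤ (Finset.univ.filter
        (fun p : F × F => p.2 = α * p.1 + β ∧ ∑ i ∈ Finset.range (s + 2), p.2 ^ q ^ i
          = p.1 ^ ((q ^ (s + 2) - 1) / (q - 1)))).card := by exact_mod_cast hle
  have e1 : ((s + 2 : ℕ) : ℝ) - 1 = s + 1 := by push_cast; ring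
  have e2 : ((s + 2 : ℕ) : ℝ) - 2 = s := by push_cast; ring
  rw [e1, e2, show s + 2 - 1 = s + 1 by omega]
  exact hfin.le.trans hle'
end

section
/- Let r ≥ 2, d = gcd(r, q−1), α ∈ F_{q^r}^× and β ∈ F_{q^r} with Tr(β) ≠ 0. Then n_{q,r}(α,β) ≥ q^{r−1} − (d − 1 + (r−1)(q−2))q^{(r−2)/2} − 1. -/
open Finset

namespace NT

/-- Modulus of a Gauss sum of a nontrivial character. -/
lemma gauss_norm_sq {K : Type*} [Field K] [Fintype K] {χ : MulChar K ℂ} (hχ : χ ≠ 1)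
    {ψ : AddChar K ℂ} (hψ : ψ.IsPrimitive) :
    ‖gaussSum χ ψ‖ ^ 2 = (Fintype.card K : ℝ) := by
  have h := gaussSum_mul_gaussSum_eq_card hχ hψ
  rw [← star_gaussSum_eq] at h
  have h2 : gaussSum χ ψ * star (gaussSum χ ψ) = ((‖gaussSum χ ψ‖ ^ 2 : ℝ) : ℂ) := by
    have := Complex.mul_conj (gaussSum χ ψ)
    rw [Complex.normSq_eq_norm_sq] at this
    exact this
  rw [h2] at h
  exact_mod_cast h

lemma gauss_norm_sq_le {K : Type*} [Field K] [Fintype K] (χ : MulChar K ℂ)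
    {ψ : AddChar K ℂ} (hψ : ψ.IsPrimitive) :
    ‖gaussSum χ ψ‖ ^ 2 ≤ (Fintype.card K : ℝ) := by
  by_cases hχ : χ = 1
  · subst hχ
    have h1 : ψ ≠ 1 := by
      intro h
      exact hψ one_ne_zero (by rw [h]; ext; simp)
    rw [gaussSum_one_left h1]
    have : 1 ≤ Fintype.card K := Fintype.card_pos
    simpa using this
  · exact (gauss_norm_sq hχ hψ).le

/-- The twisted Gauss sum formula, valid for every shift. -/
lemma gauss_shift {K : Type*} [Field K] [Fintype K] {χ : MulChar K ℂ} (hχ : χ ≠ 1)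
    (ψ : AddChar K ℂ) (u : K) :
    ∑ t, χ t * ψ (u * t) = χ⁻¹ u * gaussSum χ ψ := by
  by_cases hu : u = 0
  · subst hu
    simp [MulChar.sum_eq_zero_of_ne_one hχ, MulChar.map_zero]
  · have := gaussSum_mulShift_eq χ ψ (Units.mk0 u hu)
    simpa [gaussSum] using this

/-- Column orthogonality. -/
lemma sum_mulChar {K : Type*} [Field K] [Fintype K] [DecidableEq K] [Fintype (MulChar K ℂ)]
    (a : K) :
    ∑ χ : MulChar K ℂ, χ a = if a = 1 then ((Fintype.card K : ℂ) - 1) else 0 := by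
  split_ifs with h
  · subst h
    have h1 := MulChar.card_eq_card_units_of_hasEnoughRootsOfUnity K ℂ
    rw [Nat.card_eq_fintype_card, Nat.card_eq_fintype_card, Fintype.card_units] at h1
    simp [h1, Nat.cast_sub (Fintype.card_pos (α := K))]
  · obtain ⟨χ₀, h0⟩ := MulChar.exists_apply_ne_one_of_hasEnoughRootsOfUnity K ℂ h
    have h2 : ∑ χ : MulChar K ℂ, χ a = χ₀ a * ∑ χ : MulChar K ℂ, χ a := by
      rw [mul_sum, ← Equiv.sum_comp (Equiv.mulLeft χ₀)]
      simp
    have h3 : (χ₀ a - 1) * ∑ χ : MulChar K ℂ, χ a = 0 := by linear_combination -h2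
    exact (mul_eq_zero.mp h3).resolve_left (sub_ne_zero.mpr h0)

/-- The character `χ ∘ N`. -/
noncomputable def normChar {K : Type*} (F : Type*) [Field K] [Field F] [Algebra K F]
    [FiniteDimensional K F] (χ : MulChar K ℂ) : MulChar F ℂ where
  toFun x := χ (Algebra.norm K x)
  map_one' := by simp
  map_mul' x y := by simp
  map_nonunit' x hx := by
    have : x = 0 := by simpa using hx
    subst this
    simp [MulChar.map_zero]

lemma normChar_apply {K : Type*} (F : Type*) [Field K] [Field F] [Algebra K F]
    [FiniteDimensional K F] (χ : MulChar K ℂ) (x : F) :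
    normChar F χ x = χ (Algebra.norm K x) := rfl

lemma normChar_ne_one {K : Type*} (F : Type*) [Field K] [Field F] [Algebra K F] [Finite F]
    [FiniteDimensional K F] {χ : MulChar K ℂ} (hχ : χ ≠ 1) : normChar F χ ≠ 1 := by
  intro h
  apply hχ
  ext u
  obtain ⟨x, hx⟩ := FiniteField.unitsMap_norm_surjective K F u
  have h1 : normChar F χ (x : F) = 1 := by rw [h]; simp
  rw [normChar_apply] at h1
  rw [← hx, MulChar.one_apply_coe]
  simpa using h1

lemma trace_surj (K F : Type*) [Field K] [Field F] [Algebra K F] [Finite F]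
    [FiniteDimensional K F] : Function.Surjective (Algebra.trace K F) := by
  have : Finite K := Finite.of_injective _ (algebraMap K F).injective
  exact LinearMap.surjective (Algebra.trace_ne_zero K F)

/-- The additive character `ψ ∘ Tr`. -/
noncomputable def trChar {K : Type*} (F : Type*) [Field K] [Field F] [Algebra K F]
    (ψ : AddChar K ℂ) : AddChar F ℂ :=
  ψ.compAddMonoidHom (Algebra.trace K F).toAddMonoidHom

lemma trChar_apply {K : Type*} (F : Type*) [Field K] [Field F] [Algebra K F]
    (ψ : AddChar K ℂ) (x : F) : trChar F ψ x = ψ (Algebra.trace K F x) := rfl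

lemma trChar_prim {K : Type*} (F : Type*) [Field K] [Field F] [Algebra K F] [Finite F]
    [FiniteDimensional K F] {ψ : AddChar K ℂ} (hψ : ψ.IsPrimitive) :
    (trChar F ψ).IsPrimitive := by
  apply AddChar.IsPrimitive.of_ne_one
  intro h
  refine hψ one_ne_zero ?_
  ext u
  obtain ⟨x, hx⟩ := trace_surj K F u
  have h1 : trChar F ψ x = 1 := by rw [h]; simp
  rw [trChar_apply, hx] at h1
  simpa using h1

/-- The character sums occurring in the count. -/
noncomputable def S {K F : Type*} [Field K] [Field F] [Algebra K F] [Fintype F]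
    (χ : MulChar K ℂ) (α : F) (c : K) : ℂ :=
  ∑ x : F, χ (Algebra.norm K x) * χ⁻¹ (Algebra.trace K F (α * x) + c)

lemma S_bound {K F : Type*} [Field K] [Field F] [Algebra K F] [Fintype F] [Fintype K]
    [FiniteDimensional K F] {χ : MulChar K ℂ} (hχ : χ ≠ 1) {α : F} (hα : α ≠ 0) {c : K}
    (hc : c ≠ 0) : ‖S χ α c‖ ^ 2 ≤ (Fintype.card F : ℝ) := by
  set ψ := AddChar.FiniteField.primitiveChar_to_Complex K with hψd
  have hψ : ψ.IsPrimitive := AddChar.FiniteField.primitiveChar_to_Complex_isPrimitive K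
  set r := Module.finrank K F
  have hψc : (ψ.mulShift c).IsPrimitive := by
    apply AddChar.IsPrimitive.of_ne_one
    exact hψ hc
  have key : gaussSum χ ψ * S χ α c = (normChar F χ)⁻¹ α *
      (gaussSum (normChar F χ) (trChar F ψ) * gaussSum (χ * (χ⁻¹) ^ r) (ψ.mulShift c)) := by
    have inner : ∀ t : K, ∑ x : F, χ (Algebra.norm K x) * ψ (t * Algebra.trace K F (α * x))
        = (normChar F χ)⁻¹ α * ((χ⁻¹) ^ r) t * gaussSum (normChar F χ) (trChar F ψ) := by
      intro t
      have h := gauss_shift (normChar_ne_one F hχ) (trChar F ψ) (algebraMap K F t * α)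
      rw [map_mul, MulChar.inv_apply' (normChar F χ) (algebraMap K F t), normChar_apply,
        ← map_inv₀, Algebra.norm_algebraMap, map_pow, ← MulChar.inv_apply'] at h
      have hr : r ≠ 0 := Module.finrank_pos.ne'
      rw [MulChar.pow_apply' _ hr, mul_comm ((normChar F χ)⁻¹ α), ← h]
      refine sum_congr rfl fun x _ => ?_
      rw [normChar_apply, trChar_apply, mul_assoc, ← Algebra.smul_def, map_smul, smul_eq_mul]
    calc gaussSum χ ψ * S χ α c
        = ∑ x : F, ∑ t : K, χ (Algebra.norm K x) *
            (χ t * ψ ((Algebra.trace K F (α * x) + c) * t)) := by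
          rw [S, mul_sum]
          refine sum_congr rfl fun x _ => ?_
          rw [← mul_sum, gauss_shift hχ]
          ring
      _ = ∑ t : K, (χ t * ψ (c * t)) *
            ∑ x : F, χ (Algebra.norm K x) * ψ (t * Algebra.trace K F (α * x)) := by
          rw [sum_comm]
          refine sum_congr rfl fun t _ => ?_
          rw [mul_sum]
          refine sum_congr rfl fun x _ => ?_
          rw [add_mul, AddChar.map_add_eq_mul, mul_comm t]
          ring
      _ = _ := by
          simp_rw [inner]
          have hg : gaussSum (χ * (χ⁻¹) ^ r) (ψ.mulShift c) =
              ∑ t, (χ * (χ⁻¹) ^ r) t * (ψ.mulShift c) t := rfl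
          rw [hg, mul_sum, mul_sum]
          refine sum_congr rfl fun t _ => ?_
          simp only [MulChar.mul_apply, AddChar.mulShift_apply]
          ring
  have hn : ‖(normChar F χ)⁻¹ α‖ = 1 := by
    have h := MulChar.star_apply' (normChar F χ)⁻¹ α
    have h2 : (normChar F χ)⁻¹ α * star ((normChar F χ)⁻¹ α) = 1 := by
      rw [h, ← MulChar.mul_apply, mul_inv_cancel]
      exact MulChar.one_apply (isUnit_iff_ne_zero.mpr hα)
    have h3 := congrArg norm h2
    rw [norm_mul, norm_star, norm_one] at h3
    nlinarith [norm_nonneg ((normChar F χ)⁻¹ α)]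
  have h1 := congrArg (fun z : ℂ => ‖z‖ ^ 2) key
  simp only [norm_mul, mul_pow, hn] at h1
  rw [gauss_norm_sq hχ hψ, gauss_norm_sq (normChar_ne_one F hχ) (trChar_prim F hψ)] at h1
  have h2 := gauss_norm_sq_le (χ * (χ⁻¹) ^ r) hψc
  have hK : (0 : ℝ) < Fintype.card K := by exact_mod_cast Fintype.card_pos
  have hF : (0 : ℝ) < Fintype.card F := by exact_mod_cast Fintype.card_pos
  have h3 := mul_le_mul_of_nonneg_left h2 hF.le
  nlinarith

lemma card_trace_fiber {K F : Type*} [Field K] [Field F] [Algebra K F] [Fintype F] [Fintype K]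
    [DecidableEq K] [FiniteDimensional K F] {α : F} (hα : α ≠ 0) (c : K) :
    Fintype.card K * #{x : F | Algebra.trace K F (α * x) = c} = Fintype.card F := by
  let f : F →ₗ[K] K := (Algebra.trace K F).comp (LinearMap.mulLeft K α)
  have hf : Function.Surjective f := by
    intro y
    obtain ⟨x, hx⟩ := trace_surj K F y
    exact ⟨α⁻¹ * x, by simp [f, hα, hx]⟩
  have h1 : ∀ y : K, #{x : F | f x = y} = #{x : F | f x = c} := fun y =>
    AddMonoidHom.card_fiber_eq_of_mem_range f (hf y) (hf c)
  have h2 := Finset.card_eq_sum_card_fiberwise (s := (univ : Finset F)) (t := (univ : Finset K))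
    (f := f) (by simp)
  simp only [h1] at h2
  simp only [sum_const, smul_eq_mul, card_univ] at h2
  exact h2.symm

lemma S_one {K F : Type*} [Field K] [Field F] [Algebra K F] [Fintype F] [Fintype K]
    [DecidableEq K] [FiniteDimensional K F] {α : F} (hα : α ≠ 0) {c : K} (hc : c ≠ 0) :
    (Fintype.card K : ℂ) * S (1 : MulChar K ℂ) α c =
      Fintype.card K * Fintype.card F - Fintype.card K - Fintype.card F := by
  classical
  have h1 : ∀ x : F, (1 : MulChar K ℂ) (Algebra.norm K x) *
      (1 : MulChar K ℂ)⁻¹ (Algebra.trace K F (α * x) + c) =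
      1 - (if x = 0 then 1 else 0) - (if Algebra.trace K F (α * x) = -c then 1 else 0) := by
    intro x
    rw [inv_one]
    by_cases hx : x = 0
    · subst hx
      simp [hc, MulChar.map_zero]
    · have hN : (1 : MulChar K ℂ) (Algebra.norm K x) = 1 :=
        MulChar.one_apply (isUnit_iff_ne_zero.mpr (by simpa [Algebra.norm_eq_zero_iff] using hx))
      rw [hN, if_neg hx]
      by_cases hu : Algebra.trace K F (α * x) = -c
      · simp [hu, MulChar.map_zero]
      · rw [if_neg hu, MulChar.one_apply
          (isUnit_iff_ne_zero.mpr (fun h => hu (eq_neg_of_add_eq_zero_left h)))]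
        simp
  have h2 := card_trace_fiber (K := K) hα (-c)
  have h3 : (Fintype.card K : ℂ) * (#{x : F | Algebra.trace K F (α * x) = -c} : ℂ)
      = Fintype.card F := by exact_mod_cast h2
  rw [S]
  simp_rw [h1]
  rw [sum_sub_distrib, sum_sub_distrib, sum_boole, sum_boole]
  have h4 : #{x : F | x = 0} = 1 := by
    rw [card_eq_one]
    exact ⟨0, by ext; simp⟩
  rw [h4]
  simp only [sum_const, card_univ, nsmul_eq_mul, mul_one, Nat.cast_one]
  linear_combination -h3

lemma sum_S {K F : Type*} [Field K] [Field F] [Algebra K F] [Fintype F] [Fintype K]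
    [DecidableEq K] [FiniteDimensional K F] [Fintype (MulChar K ℂ)] (α : F) {c : K}
    (hc : c ≠ 0) :
    ∑ χ : MulChar K ℂ, S χ α c = ((Fintype.card K : ℂ) - 1) *
      #{x : F | Algebra.trace K F (α * x) + c = Algebra.norm K x} := by
  simp_rw [S]
  rw [sum_comm, ← sum_boole, mul_sum]
  refine sum_congr rfl fun x _ => ?_
  simp_rw [MulChar.inv_apply', ← map_mul]
  rw [sum_mulChar]
  have : Algebra.norm K x * (Algebra.trace K F (α * x) + c)⁻¹ = 1 ↔
      Algebra.trace K F (α * x) + c = Algebra.norm K x := by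
    by_cases hu : Algebra.trace K F (α * x) + c = 0
    · rw [hu]
      simp only [inv_zero, mul_zero, zero_ne_one, false_iff]
      intro h
      have hx : x = 0 := Algebra.norm_eq_zero_iff.mp h.symm
      subst hx
      simp at hu
      exact hc hu
    · rw [mul_inv_eq_one₀ hu, eq_comm]
  simp only [this]
  split_ifs <;> simp

lemma abstract_bound {K F : Type*} [Field K] [Field F] [Algebra K F] [Fintype F] [Fintype K]
    [DecidableEq K] [FiniteDimensional K F] {α : F} (hα : α ≠ 0) {c : K} (hc : c ≠ 0)
    {Q : ℝ} (hQ : 0 ≤ Q) (hQ2 : Q ^ 2 = Fintype.card F) :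
    (Fintype.card F : ℝ) - 1 - Fintype.card F / Fintype.card K
      - ((Fintype.card K : ℝ) - 2) * Q ≤ ((Fintype.card K : ℝ) - 1) *
      #{x : F | Algebra.trace K F (α * x) + c = Algebra.norm K x} := by
  classical
  have : Fintype (MulChar K ℂ) := Fintype.ofFinite _
  have hS := sum_S α hc
  have h1 := S_one hα hc
  have hK : (Fintype.card K : ℂ) ≠ 0 := by exact_mod_cast Fintype.card_pos.ne'
  have hK' : (Fintype.card K : ℝ) ≠ 0 := by exact_mod_cast Fintype.card_pos.ne'
  rw [← sum_erase_add _ _ (mem_univ (1 : MulChar K ℂ))] at hS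
  have hcard : #(univ.erase (1 : MulChar K ℂ)) = (Fintype.card K : ℝ) - 2 := by
    have h1 := MulChar.card_eq_card_units_of_hasEnoughRootsOfUnity K ℂ
    rw [Nat.card_eq_fintype_card, Nat.card_eq_fintype_card, Fintype.card_units] at h1
    have h2 : 2 ≤ Fintype.card K := Fintype.one_lt_card
    rw [card_erase_of_mem (mem_univ _), card_univ, h1, Nat.sub_sub, Nat.cast_sub h2]
    simp
  have hb : ‖∑ χ ∈ univ.erase (1 : MulChar K ℂ), S χ α c‖ ≤ ((Fintype.card K : ℝ) - 2) * Q := by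
    rw [← hcard, ← nsmul_eq_mul]
    refine norm_sum_le_of_le _ (fun χ hχ => ?_) |>.trans (by rw [sum_const])
    have := S_bound (ne_of_mem_erase hχ) hα hc
    rw [← hQ2] at this
    exact le_of_sq_le_sq this hQ
  set E := ∑ χ ∈ univ.erase (1 : MulChar K ℂ), S χ α c
  have hE : E = (((((Fintype.card K : ℝ) - 1) *
      #{x : F | Algebra.trace K F (α * x) + c = Algebra.norm K x} -
      ((Fintype.card F : ℝ) - 1 - Fintype.card F / Fintype.card K)) : ℝ) : ℂ) := by
    have h4 : S (1 : MulChar K ℂ) α c = Fintype.card F - 1 - Fintype.card F / Fintype.card K := by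
      field_simp
      linear_combination h1
    rw [h4] at hS
    push_cast
    linear_combination hS
  rw [hE, Complex.norm_real, Real.norm_eq_abs] at hb
  have := neg_le_of_abs_le hb
  linarith

lemma arith {q r n d P A : ℝ} (hq : 2 ≤ q) (hd : 1 ≤ d) (hP : 1 ≤ P)
    (hr : 3 ≤ r ∨ (r = 2 ∧ P = 1))
    (h : q * A - 1 - A - (q - 2) * (q * P) ≤ (q - 1) * n) :
    A - (d - 1 + (r - 1) * (q - 2)) * P - 1 ≤ n := by
  have hq1 : 0 < q - 1 := by linarith
  refine le_of_mul_le_mul_left ?_ hq1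
  refine le_trans ?_ h
  have h1 : 0 ≤ (q - 1) * ((d - 1) * P) := by
    have : 0 ≤ d - 1 := by linarith
    positivity
  rcases hr with hr | ⟨rfl, rfl⟩
  · have h2 : 0 ≤ (q - 2) * P := mul_nonneg (by linarith) (by linarith)
    have h3 : 0 ≤ (q - 1) * (r - 1) - q := by nlinarith
    have h4 := mul_nonneg h2 h3
    nlinarith
  · nlinarith

lemma main_aux2 {K F : Type*} [Field K] [Fintype K] [Field F] [Algebra K F]
    [Fintype F] [DecidableEq F] (q r : ℕ)
    (hr : 2 ≤ r) (hK : Fintype.card K = q)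
    (hcard : Fintype.card F = q ^ r) (α β : F) (hα : α ≠ 0)
    (htr : (∑ i ∈ Finset.range r, β ^ q ^ i) ≠ 0) :
    ((Finset.univ.filter
        (fun p : F × F => p.2 = α * p.1 + β ∧
          ∑ i ∈ Finset.range r, p.2 ^ q ^ i = p.1 ^ ((q ^ r - 1) / (q - 1)))).card : ℝ)
      ≥ (q : ℝ) ^ (r - 1)
        - ((Nat.gcd r (q - 1) : ℝ) - 1 + ((r : ℝ) - 1) * ((q : ℝ) - 2))
            * (q : ℝ) ^ (((r : ℝ) - 2) / 2)
        - 1 := by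
  classical
  have hq2 : 2 ≤ q := hK ▸ Fintype.one_lt_card
  have hfin : FiniteDimensional K F := Module.Finite.of_finite
  have hfr : Module.finrank K F = r := by
    have h := Module.card_eq_pow_finrank (K := K) (V := F)
    rw [hK, hcard] at h
    exact (Nat.pow_right_injective hq2 h).symm
  have htrace : ∀ x : F, ∑ i ∈ Finset.range r, x ^ q ^ i =
      algebraMap K F (Algebra.trace K F x) := by
    intro x
    rw [FiniteField.algebraMap_trace_eq_sum_pow, hfr, Nat.card_eq_fintype_card, hK]
  have hnorm : ∀ x : F, x ^ ((q ^ r - 1) / (q - 1)) = algebraMap K F (Algebra.norm K x) := by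
    intro x
    rw [FiniteField.algebraMap_norm_eq_pow, Nat.card_eq_fintype_card, Nat.card_eq_fintype_card,
      hK, hcard]
  have hc : Algebra.trace K F β ≠ 0 := by
    intro h
    rw [htrace, h, map_zero] at htr
    exact htr rfl
  have hqR : (2 : ℝ) ≤ q := by exact_mod_cast hq2
  have hq0 : (0 : ℝ) < q := by linarith
  set P : ℝ := (q : ℝ) ^ (((r : ℝ) - 2) / 2) with hPd
  have hP1 : 1 ≤ P := Real.one_le_rpow (by linarith) (by
    have : (2 : ℝ) ≤ r := by exact_mod_cast hr
    linarith)
  have hQ2 : ((q : ℝ) * P) ^ 2 = Fintype.card F := by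
    rw [hcard, mul_pow, hPd, ← Real.rpow_natCast ((q : ℝ) ^ (((r : ℝ) - 2) / 2)) 2,
      ← Real.rpow_mul hq0.le, ← Real.rpow_natCast (q : ℝ) 2, ← Real.rpow_add hq0]
    push_cast
    rw [← Real.rpow_natCast (q : ℝ) r]
    congr 1
    ring
  have hb := abstract_bound hα hc (Q := (q : ℝ) * P) (by positivity) hQ2
  have hle : #{x : F | Algebra.trace K F (α * x) + Algebra.trace K F β = Algebra.norm K x} ≤
      #(Finset.univ.filter
        (fun p : F × F => p.2 = α * p.1 + β ∧
          ∑ i ∈ Finset.range r, p.2 ^ q ^ i = p.1 ^ ((q ^ r - 1) / (q - 1)))) := by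
    refine card_le_card_of_injOn (fun x => (x, α * x + β)) ?_ ?_
    · intro x hx
      simp only [coe_filter, mem_univ, true_and, Set.mem_setOf_eq] at hx ⊢
      rw [htrace, hnorm, map_add, hx]
    · intro x _ y _ h
      exact (Prod.mk.inj h).1
  have hle' : (#{x : F | Algebra.trace K F (α * x) + Algebra.trace K F β = Algebra.norm K x} : ℝ)
      ≤ _ := Nat.cast_le.mpr hle
  refine le_trans ?_ hle'
  have hA : (Fintype.card F : ℝ) = q * (q : ℝ) ^ (r - 1) := by
    rw [hcard, ← pow_succ', Nat.sub_add_cancel (by omega)]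
    push_cast
    rfl
  have hd : (1 : ℝ) ≤ (Nat.gcd r (q - 1) : ℝ) := by
    exact_mod_cast Nat.gcd_pos_of_pos_left _ (by omega)
  refine arith hqR hd hP1 ?_ ?_
  · rcases hr.eq_or_lt with h | h
    · right
      subst h
      refine ⟨by norm_num, ?_⟩
      rw [hPd]
      norm_num
    · left
      exact_mod_cast h
  · rw [hK, hA, mul_div_cancel_left₀ _ hq0.ne'] at hb
    exact hb

lemma main_aux {F : Type*} [Field F]
    [Fintype F] [DecidableEq F] (q r : ℕ)
    (hq : ∃ p k : ℕ, p.Prime ∧ 0 < k ∧ q = p ^ k) (hr : 2 ≤ r)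
    (hcard : Fintype.card F = q ^ r) (α β : F) (hα : α ≠ 0)
    (htr : (∑ i ∈ Finset.range r, β ^ q ^ i) ≠ 0) :
    ((Finset.univ.filter
        (fun p : F × F => p.2 = α * p.1 + β ∧
          ∑ i ∈ Finset.range r, p.2 ^ q ^ i = p.1 ^ ((q ^ r - 1) / (q - 1)))).card : ℝ)
      ≥ (q : ℝ) ^ (r - 1)
        - ((Nat.gcd r (q - 1) : ℝ) - 1 + ((r : ℝ) - 1) * ((q : ℝ) - 2))
            * (q : ℝ) ^ (((r : ℝ) - 2) / 2)
        - 1 := by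
  obtain ⟨p, k, hp, hk, hqp⟩ := hq
  have : Fact p.Prime := ⟨hp⟩
  have hcard' : Fintype.card F = p ^ (k * r) := by rw [hcard, pow_mul, hqp]
  have hchar : CharP F p := charP_of_card_eq_prime_pow hcard'
  let _ : Algebra (ZMod p) F := ZMod.algebra F p
  have hfr : Module.finrank (ZMod p) F = k * r := by
    have h := Module.card_eq_pow_finrank (K := ZMod p) (V := F)
    rw [ZMod.card, hcard'] at h
    exact (Nat.pow_right_injective hp.two_le h).symm
  obtain ⟨φ⟩ := FiniteField.nonempty_algHom_of_finrank_dvd (F := ZMod p)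
    (K := GaloisField p k) (L := F) (by rw [GaloisField.finrank p hk.ne', hfr]; exact ⟨r, rfl⟩)
  have hKc : Nat.card (GaloisField p k) = q := by rw [GaloisField.card p k hk.ne', hqp]
  let _ : Algebra (GaloisField p k) F := φ.toRingHom.toAlgebra
  have : Fintype (GaloisField p k) := Fintype.ofFinite _
  exact main_aux2 (K := GaloisField p k) q r hr
    (by rw [← hKc, Nat.card_eq_fintype_card]) hcard α β hα htr

end NT

/-- For `r ≥ 2`, `d = gcd(r, q-1)`, `α ≠ 0` and `Tr(β) ≠ 0`, the number of
affine `F_{q^r}`-points of the norm-trace curve on the line `y = αx + β` satisfies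
`n_{q,r}(α,β) ≥ q^(r-1) - (d - 1 + (r-1)(q-2))q^((r-2)/2) - 1`. -/
theorem norm_trace_intersection_lower_bound_trace_nonzero {F : Type*} [Field F]
    [Fintype F] [DecidableEq F] (q r : ℕ)
    (hq : ∃ p k : ℕ, p.Prime ∧ 0 < k ∧ q = p ^ k) (hr : 2 ≤ r)
    (hcard : Fintype.card F = q ^ r) (α β : F) (hα : α ≠ 0)
    (htr : (∑ i ∈ Finset.range r, β ^ q ^ i) ≠ 0) :
    ((Finset.univ.filter
        (fun p : F × F => p.2 = α * p.1 + β ∧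
          ∑ i ∈ Finset.range r, p.2 ^ q ^ i = p.1 ^ ((q ^ r - 1) / (q - 1)))).card : ℝ)
      ≥ (q : ℝ) ^ (r - 1)
        - ((Nat.gcd r (q - 1) : ℝ) - 1 + ((r : ℝ) - 1) * ((q : ℝ) - 2))
            * (q : ℝ) ^ (((r : ℝ) - 2) / 2)
        - 1 := by
  exact NT.main_aux q r hq hr hcard α β hα htr
end
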